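/- If G is a finite connected unicyclic graph (a connected simple graph whose number of edges equals its number of vertices) that is not isomorphic to the cycle C_5, then χ_so(G) ≤ 4. -/

import Mathlib

/-- A strong odd coloring of a simple graph: a proper vertex coloring such that for every
vertex `v` and every color `c`, the number of neighbors of `v` colored `c` is zero or odd. -/
def SimpleGraph.IsStrongOddColoring {V α : Type*} (G : SimpleGraph V) (φ : V → α) : Prop :=
  (∀ ⦃u v⦄, G.Adj u v → φ u ≠ φ v) ∧
    ∀ v c, Nat.card {u // G.Adj v u ∧ φ u = c} = 0 ∨
      Odd (Nat.card {u // G.Adj v u ∧ φ u = c})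

/-- The strong odd chromatic number: the least `k` such that there is a strong odd
coloring using `k` colors. -/
noncomputable def SimpleGraph.strongOddChromaticNumber {V : Type*} (G : SimpleGraph V) : ℕ :=
  sInf {k | ∃ φ : V → Fin k, G.IsStrongOddColoring φ}

/-- The edges of a connected unicyclic graph are exactly the pairs `{v, f v}` for some self-map
`f` of the vertex set whose iterates bring every vertex down to a root `a`. -/
theorem SimpleGraph.exists_parent_map {V : Type*} [Fintype V] {G : SimpleGraph V}
    (hconn : G.Connected) (hcard : Nat.card G.edgeSet = Fintype.card V) :
    ∃ (f : V → V) (h : V → ℕ) (a : V), (∀ v, h v = 0 ↔ v = a) ∧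
      (∀ v, v ≠ a → h v = h (f v) + 1) ∧ 2 ≤ h (f a) ∧
      ∀ u v, G.Adj u v ↔ f u = v ∨ f v = u := by
  classical
  have hnac : ¬ G.IsAcyclic := fun hac => by
    have h1 := SimpleGraph.IsTree.card_edgeFinset (G := G) ⟨hconn, hac⟩
    rw [← hcard, Nat.card_eq_fintype_card, ← SimpleGraph.edgeFinset_card] at h1
    omega
  rw [SimpleGraph.isAcyclic_iff_forall_adj_isBridge] at hnac
  push Not at hnac
  obtain ⟨a, b, hab, hbr⟩ := hnac
  have hH := hconn.connected_delete_edge_of_not_isBridge hbr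
  set H := G.deleteEdges {s(a, b)} with hHdef
  have hHadj : ∀ u v, H.Adj u v ↔ G.Adj u v ∧ s(u, v) ≠ s(a, b) := by
    intro u v
    simp [hHdef]
  have hstep : ∀ v, v ≠ a → ∃ w, H.Adj v w ∧ H.dist v a = H.dist w a + 1 := by
    intro v hv
    obtain ⟨p, hp⟩ := hH.exists_walk_length_eq_dist v a
    cases p with
    | nil => exact absurd rfl hv
    | @cons _ w _ hvw q =>
      refine ⟨w, hvw, ?_⟩
      rw [SimpleGraph.Walk.length_cons] at hp
      obtain ⟨r, hr⟩ := hH.exists_walk_length_eq_dist w a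
      have h1 := SimpleGraph.dist_le q
      have h2 := SimpleGraph.dist_le (SimpleGraph.Walk.cons hvw r)
      rw [SimpleGraph.Walk.length_cons] at h2
      omega
  choose! p hp hpd using hstep
  set f : V → V := fun v => if v = a then b else p v with hf
  have hfa : f a = b := by simp [hf]
  have hfp : ∀ v, v ≠ a → f v = p v := fun v hv => by simp [hf, hv]
  have hh0 : ∀ v, H.dist v a = 0 ↔ v = a := fun v => hH.dist_eq_zero_iff
  have hhs : ∀ v, v ≠ a → H.dist v a = H.dist (f v) a + 1 := fun v hv => by
    rw [hfp v hv]; exact hpd v hv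
  have hb2 : 2 ≤ H.dist (f a) a := by
    rw [hfa]
    have h0 : H.dist b a ≠ 0 := fun h => hab.ne ((hh0 b).1 h).symm
    have h1 : H.dist b a ≠ 1 := fun h => by
      have := (hHadj b a).1 (SimpleGraph.dist_eq_one_iff_adj.1 h)
      exact this.2 Sym2.eq_swap
    omega
  have hfadj : ∀ v, G.Adj v (f v) := by
    intro v
    by_cases hv : v = a
    · rw [hv, hfa]; exact hab
    · rw [hfp v hv]; exact ((hHadj _ _).1 (hp v hv)).1
  refine ⟨f, fun v => H.dist v a, a, hh0, hhs, hb2, fun u v => ⟨fun huv => ?_, ?_⟩⟩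
  · let e : V → G.edgeSet := fun v => ⟨s(v, f v), hfadj v⟩
    have hinj : Function.Injective e := by
      intro x y hxy
      have hxy' : s(x, f x) = s(y, f y) := congrArg Subtype.val hxy
      rcases Sym2.eq_iff.1 hxy' with h | ⟨h1, h2⟩
      · exact h.1
      · exfalso
        have hx := hhs x
        have hy := hhs y
        rw [h2] at hx
        rw [← h1] at hy
        by_cases hxa : x = a <;> by_cases hya : y = a
        · exact (hfadj y).ne (hya.trans (hxa.symm.trans h1))
        · have hx0 := (hh0 x).2 hxa
          rw [hxa] at h2
          rw [h2] at hb2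
          have := hy hya
          omega
        · have hy0 := (hh0 y).2 hya
          rw [hya] at h1
          rw [← h1] at hb2
          have := hx hxa
          omega
        · have := hx hxa
          have := hy hya
          omega
    have hbij : Function.Bijective e :=
      (Fintype.bijective_iff_injective_and_card e).2
        ⟨hinj, by rw [← hcard, Nat.card_eq_fintype_card]⟩
    obtain ⟨w, hw⟩ := hbij.2 ⟨s(u, v), huv⟩
    have hw' : s(w, f w) = s(u, v) := congrArg Subtype.val hw
    rcases Sym2.eq_iff.1 hw' with ⟨h1, h2⟩ | ⟨h1, h2⟩
    · left; rw [← h1, h2]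
    · right; rw [← h1, h2]
  · rintro (h | h)
    · rw [← h]; exact hfadj u
    · rw [← h]; exact (hfadj v).symm

/-- Given neighbors `A` of a vertex, with at most two elements and already colored avoiding `c`,
one can color a disjoint set `K` of further neighbors avoiding `c` so that each color occurs
zero or an odd number of times. -/
theorem exists_recolor_odd {V : Type*} [DecidableEq V] (φ : V → Fin 4) (c : Fin 4) (p q : V)
    (K : Finset V) (hp : φ p ≠ c) (hq : φ q ≠ c) (hpK : p ∉ K) (hqK : q ∉ K)
    (hK : K.Nonempty ∨ p = q ∨ φ p ≠ φ q) :
    ∃ ψ : V → Fin 4, (∀ x, x ∉ K → ψ x = φ x) ∧ (∀ x ∈ K, ψ x ≠ c) ∧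
      ∀ e, ((({p, q} : Finset V) ∪ K).filter (fun x => ψ x = e)).card = 0 ∨
        Odd ((({p, q} : Finset V) ∪ K).filter (fun x => ψ x = e)).card := by
  have count : ∀ (χ : V → Fin 4) (e : Fin 4),
      ((({p, q} : Finset V) ∪ K).filter
        (fun x => (if x ∈ K then χ x else φ x) = e)).card =
      (({p, q} : Finset V).filter (fun x => φ x = e)).card +
        (K.filter (fun x => χ x = e)).card := by
    intro χ e
    rw [Finset.filter_union, Finset.card_union_of_disjoint]
    · congr 2
      · apply Finset.filter_congr
        intro x hx
        have : x ∉ K := by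
          rcases Finset.mem_insert.1 hx with rfl | hx
          · exact hpK
          · rw [Finset.mem_singleton.1 hx]; exact hqK
        simp [this]
      · apply Finset.filter_congr
        intro x hx
        simp [hx]
    · apply Finset.disjoint_filter_filter
      simp [hpK, hqK]
  suffices h : ∃ χ : V → Fin 4, (∀ x ∈ K, χ x ≠ c) ∧
      ∀ e, (({p, q} : Finset V).filter (fun x => φ x = e)).card +
        (K.filter (fun x => χ x = e)).card = 0 ∨
        Odd ((({p, q} : Finset V).filter (fun x => φ x = e)).card +
        (K.filter (fun x => χ x = e)).card) by
    obtain ⟨χ, hχ, hodd⟩ := h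
    refine ⟨fun x => if x ∈ K then χ x else φ x, fun x hx => by simp [hx],
      fun x hx => by simpa [hx] using hχ x hx, fun e => ?_⟩
    rw [count χ e]
    exact hodd e
  have hthird : ∀ x y z : Fin 4, ∃ w, w ≠ x ∧ w ≠ y ∧ w ≠ z := by decide
  obtain ⟨γ, hγc, hγp, hγq⟩ := hthird c (φ p) (φ q)
  have const : ∀ d e : Fin 4, (K.filter (fun _ => d = e)).card = if d = e then K.card else 0 := by
    intro d e
    split_ifs with h <;> simp [h]
  by_cases heq : p ≠ q ∧ φ p = φ q
  · obtain ⟨hpq, hφ⟩ := heq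
    have hA : ∀ e, (({p, q} : Finset V).filter (fun x => φ x = e)).card =
        if φ p = e then 2 else 0 := by
      intro e
      rw [Finset.filter_insert, Finset.filter_singleton, ← hφ]
      split_ifs <;> simp [hpq]
    obtain ⟨x, hx⟩ : K.Nonempty := by tauto
    rcases Nat.even_or_odd K.card with hev | hod
    · refine ⟨fun y => if y = x then γ else φ p, fun y _ => by dsimp only; split_ifs <;> assumption,
        fun e => ?_⟩
      have hKe : (K.filter (fun y => (if y = x then γ else φ p) = e)).card =
          (if γ = e then 1 else 0) + if φ p = e then K.card - 1 else 0 := by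
        rw [← Finset.insert_erase hx, Finset.filter_insert,
          Finset.filter_congr (q := fun _ => φ p = e) (s := K.erase x)
            (fun y hy => by simp [Finset.ne_of_mem_erase hy])]
        have : γ ≠ φ p := hγp
        simp only [if_true]
        split_ifs with h1 h2 h2 <;> simp_all
      have hpos := Finset.card_pos.2 ⟨x, hx⟩
      rw [hA, hKe]
      obtain ⟨m, hm⟩ := hev
      split_ifs with h1 h2 h2
      · exact absurd (h2.trans h1.symm) hγp
      · right; exact ⟨m, by omega⟩
      · right; exact ⟨0, by omega⟩
      · left; rfl
    · refine ⟨fun _ => φ p, fun y _ => hp, fun e => ?_⟩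
      rw [hA, const]
      obtain ⟨m, hm⟩ := hod
      split_ifs with h1
      · right; exact ⟨m + 1, by omega⟩
      · left; rfl
  · have hA : ∀ e, (({p, q} : Finset V).filter (fun x => φ x = e)).card =
        if φ p = e ∨ φ q = e then 1 else 0 := by
      intro e
      rw [Finset.filter_insert, Finset.filter_singleton]
      by_cases hpq : p = q
      · subst hpq
        split_ifs <;> simp_all
      · have : φ p ≠ φ q := fun h => heq ⟨hpq, h⟩
        split_ifs <;> simp_all
    rcases Nat.even_or_odd K.card with ⟨m, hm⟩ | ⟨m, hm⟩
    · refine ⟨fun _ => φ p, fun y _ => hp, fun e => ?_⟩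
      rw [hA, const]
      split_ifs with h1 h2 h2
      · right; exact ⟨m, by omega⟩
      · right; exact ⟨0, rfl⟩
      · exact absurd (Or.inl h2) h1
      · left; rfl
    · refine ⟨fun _ => γ, fun y _ => hγc, fun e => ?_⟩
      rw [hA, const]
      split_ifs with h1 h2 h2
      · rcases h1 with h1 | h1
        · exact absurd (h2.trans h1.symm) hγp
        · exact absurd (h2.trans h1.symm) hγq
      · right; exact ⟨0, rfl⟩
      · right; exact ⟨m, by omega⟩
      · left; rfl

/-- Colors along a cycle of length `N ≥ 3`: adjacent positions get different colors, and so do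
positions at distance two, except around one prescribed position when `N = 5`. -/
theorem exists_cycle_colors (N s : ℕ) (hN : 3 ≤ N) (hs : N = 5 → s < 5) :
    ∃ g : ℕ → Fin 4, ∀ i j k, i < N → (j = if i = 0 then N - 1 else i - 1) →
      (k = if j = 0 then N - 1 else j - 1) →
      g i ≠ g j ∧ (g i = g k → N = 5 ∧ j = s) := by
  by_cases h5 : N = 5
  · subst h5
    have hs5 := hs rfl
    refine ⟨fun i => if (i + 5 - s) % 5 = 4 then 1 else Fin.ofNat 4 ((i + 5 - s) % 5), ?_⟩
    rintro i j k hi rfl rfl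
    clear hs hN
    revert s i
    decide
  · suffices h : ∃ g : ℕ → ℕ, (∀ i, g i < 4) ∧ ∀ i j k, i < N →
        (j = if i = 0 then N - 1 else i - 1) → (k = if j = 0 then N - 1 else j - 1) →
        g i ≠ g j ∧ g i ≠ g k by
      obtain ⟨g, hg, hgN⟩ := h
      refine ⟨fun i => ⟨g i, hg i⟩, fun i j k hi hj hk => ?_⟩
      obtain ⟨h1, h2⟩ := hgN i j k hi hj hk
      exact ⟨fun h => h1 (congrArg Fin.val h), fun h => absurd (congrArg Fin.val h) h2⟩
    have hmod : N % 3 = 0 ∨ N % 3 = 1 ∨ N % 3 = 2 := by omega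
    rcases hmod with h | h | h
    · refine ⟨fun i => i % 3, fun i => by dsimp only; omega, fun i j k hi hj hk => ?_⟩
      dsimp only
      split_ifs at hj hk <;> omega
    · refine ⟨fun i => if i + 1 = N then 3 else i % 3, fun i => by dsimp only; split_ifs <;> omega,
        fun i j k hi hj hk => ?_⟩
      dsimp only
      split_ifs at hj hk ⊢ <;> omega
    · refine ⟨fun i => if i + 8 < N then i % 3 else (i + 8 - N) % 4,
        fun i => by dsimp only; split_ifs <;> omega, fun i j k hi hj hk => ?_⟩
      dsimp only
      split_ifs at hj hk ⊢ <;> omega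

/-- A suitable coloring of the vertices of rank `0` extends along a parent map `f`. Here `r` gives
the unique preimage of rank `0` of a vertex of rank `0`. -/
theorem exists_extend_odd {V : Type*} [Fintype V] [DecidableEq V] (f r : V → V) (m : V → ℕ)
    (φ₀ : V → Fin 4) (hm : ∀ v, m v ≠ 0 → m v = m (f v) + 1) (hff : ∀ v, f (f v) ≠ v)
    (hf0 : ∀ v, m v = 0 → m (f v) = 0) (hr0 : ∀ v, m v = 0 → m (r v) = 0)
    (hfr : ∀ v, m v = 0 → f (r v) = v) (hr : ∀ v, m v = 0 → r (f v) = v)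
    (h₁ : ∀ v, m v = 0 → φ₀ v ≠ φ₀ (f v))
    (h₂ : ∀ v, m v = 0 → φ₀ v = φ₀ (f (f v)) → ∃ x, m x ≠ 0 ∧ f x = f v) :
    ∃ φ : V → Fin 4, (∀ v, φ v ≠ φ (f v)) ∧
      ∀ u e, (Finset.univ.filter (fun x => (f u = x ∨ f x = u) ∧ φ x = e)).card = 0 ∨
        Odd (Finset.univ.filter (fun x => (f u = x ∨ f x = u) ∧ φ x = e)).card := by
  have key : ∀ k, ∃ φ : V → Fin 4, (∀ v, m v = 0 → φ v = φ₀ v) ∧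
      ∀ u, m u < k → (∀ x, m x ≠ 0 → f x = u → φ x ≠ φ u) ∧
        ∀ e, (Finset.univ.filter (fun x => (f u = x ∨ f x = u) ∧ φ x = e)).card = 0 ∨
          Odd (Finset.univ.filter (fun x => (f u = x ∨ f x = u) ∧ φ x = e)).card := by
    intro k
    induction k with
    | zero => exact ⟨φ₀, fun _ _ => rfl, fun u hu => absurd hu (Nat.not_lt_zero _)⟩
    | succ k ih =>
      obtain ⟨φ, hφ0, hφ⟩ := ih
      have hstep : ∀ u, m u = k → ∃ ψ : V → Fin 4,
          (∀ x, ¬ (f x = u ∧ m x ≠ 0) → ψ x = φ x) ∧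
          (∀ x, f x = u ∧ m x ≠ 0 → ψ x ≠ φ u) ∧
          ∀ e, (Finset.univ.filter (fun x => (f u = x ∨ f x = u) ∧ ψ x = e)).card = 0 ∨
            Odd (Finset.univ.filter (fun x => (f u = x ∨ f x = u) ∧ ψ x = e)).card := by
        intro u hu
        set K : Finset V := Finset.univ.filter (fun x => f x = u ∧ m x ≠ 0) with hK
        have hmem : ∀ x, x ∈ K ↔ f x = u ∧ m x ≠ 0 := fun x => by simp [hK]
        have hpK : f u ∉ K := fun h => hff u ((hmem _).1 h).1
        obtain ⟨q, hq, hqK, hKq, hN⟩ : ∃ q, φ q ≠ φ u ∧ q ∉ K ∧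
            (K.Nonempty ∨ f u = q ∨ φ (f u) ≠ φ q) ∧
            ∀ x, (f u = x ∨ f x = u) ↔ x ∈ ({f u, q} : Finset V) ∪ K := by
          by_cases hu0 : m u = 0
          · refine ⟨r u, ?_, ?_, ?_, fun x => ?_⟩
            · rw [hφ0 _ hu0, hφ0 _ (hr0 u hu0)]
              have := h₁ (r u) (hr0 u hu0)
              rwa [hfr u hu0] at this
            · rw [hmem]
              exact fun h => h.2 (hr0 u hu0)
            · by_cases hc : φ (f u) = φ (r u)
              · left
                rw [hφ0 _ (hf0 u hu0), hφ0 _ (hr0 u hu0)] at hc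
                obtain ⟨x, hx, hfx⟩ := h₂ (r u) (hr0 u hu0) (by rw [hfr u hu0, hc])
                exact ⟨x, (hmem x).2 ⟨hfx.trans (hfr u hu0), hx⟩⟩
              · exact Or.inr (Or.inr hc)
            · simp only [Finset.mem_union, Finset.mem_insert, Finset.mem_singleton, hmem]
              constructor
              · rintro (h | h)
                · exact Or.inl (Or.inl h.symm)
                · by_cases hx : m x = 0
                  · exact Or.inl (Or.inr (by rw [← h, hr x hx]))
                  · exact Or.inr ⟨h, hx⟩
              · rintro ((h | h) | h)
                · exact Or.inl h.symm
                · exact Or.inr (by rw [h, hfr u hu0])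
                · exact Or.inr h.1
          · have hfu := hm u hu0
            refine ⟨f u, ((hφ (f u) (by omega)).1 u hu0 rfl).symm, hpK, Or.inr (Or.inl rfl),
              fun x => ?_⟩
            simp only [Finset.mem_union, Finset.mem_insert, Finset.mem_singleton, hmem, or_self]
            constructor
            · rintro (h | h)
              · exact Or.inl h.symm
              · refine Or.inr ⟨h, fun hx => hu0 ?_⟩
                rw [← h]
                exact hf0 x hx
            · rintro (h | h)
              · exact Or.inl h.symm
              · exact Or.inr h.1
        have hp : φ (f u) ≠ φ u := by
          by_cases hu0 : m u = 0
          · rw [hφ0 _ hu0, hφ0 _ (hf0 u hu0)]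
            exact (h₁ u hu0).symm
          · have hfu := hm u hu0
            exact ((hφ (f u) (by omega)).1 u hu0 rfl).symm
        obtain ⟨ψ, hψ1, hψ2, hψ3⟩ := exists_recolor_odd φ (φ u) (f u) q K hp hq hpK hqK hKq
        refine ⟨ψ, fun x hx => hψ1 x (fun h => hx ((hmem x).1 h)),
          fun x hx => hψ2 x ((hmem x).2 hx), fun e => ?_⟩
        have : Finset.univ.filter (fun x => (f u = x ∨ f x = u) ∧ ψ x = e) =
            (({f u, q} : Finset V) ∪ K).filter (fun x => ψ x = e) := by
          ext x
          rw [Finset.mem_filter, Finset.mem_filter, hN]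
          simp only [Finset.mem_univ, true_and]
        rw [this]
        exact hψ3 e
      choose! ψ hψ1 hψ2 hψ3 using hstep
      set φ' : V → Fin 4 := fun x => if m x = k + 1 then ψ (f x) x else φ x with hφ'
      have hlow : ∀ x, m x ≤ k → φ' x = φ x := fun x hx => by
        have : m x ≠ k + 1 := by omega
        simp [hφ', this]
      have hnb : ∀ u x, (f u = x ∨ f x = u) → m x ≤ m u + 1 := by
        rintro u x (rfl | rfl)
        · by_cases hu0 : m u = 0
          · rw [hf0 u hu0]; omega
          · have := hm u hu0
            omega
        · by_cases hx0 : m x = 0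
          · omega
          · exact (hm x hx0).le
      refine ⟨φ', fun v hv => by rw [hlow v (by omega), hφ0 v hv], fun u hu => ?_⟩
      rcases Nat.lt_succ_iff_lt_or_eq.1 hu with hu | hu
      · obtain ⟨hg1, hg2⟩ := hφ u hu
        refine ⟨fun x hx hfx => ?_, fun e => ?_⟩
        · have := hnb u x (Or.inr hfx)
          rw [hlow x (by omega), hlow u (by omega)]
          exact hg1 x hx hfx
        · rw [Finset.filter_congr (q := fun x => (f u = x ∨ f x = u) ∧ φ x = e)]
          · exact hg2 e
          · intro x _
            refine and_congr_right fun hx => ?_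
            have := hnb u x hx
            rw [hlow x (by omega)]
      · have hψ' : ∀ x, (f u = x ∨ f x = u) → φ' x = ψ u x := by
          intro x hx
          by_cases hxk : m x = k + 1
          · have hfx : f x = u := by
              rcases hx with rfl | hx
              · exfalso
                by_cases hu0 : m u = 0
                · have := hf0 u hu0
                  omega
                · have := hm u hu0
                  omega
              · exact hx
            simp [hφ', hxk, hfx]
          · have hle := hnb u x hx
            rw [hlow x (by omega)]
            refine (hψ1 u hu x fun h => ?_).symm
            have := hm x h.2
            rw [h.1] at this
            omega
        refine ⟨fun x hx hfx => ?_, fun e => ?_⟩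
        · rw [hψ' x (Or.inr hfx), hlow u hu.le]
          exact hψ2 u hu x ⟨hfx, hx⟩
        · rw [Finset.filter_congr (q := fun x => (f u = x ∨ f x = u) ∧ ψ u x = e)]
          · exact hψ3 u hu e
          · intro x _
            exact and_congr_right fun hx => by rw [hψ' x hx]
  obtain ⟨φ, hφ0, hφ⟩ := key (Finset.univ.sup m + 1)
  have hlt : ∀ v, m v < Finset.univ.sup m + 1 := fun v =>
    Nat.lt_succ_of_le (Finset.le_sup (Finset.mem_univ v))
  refine ⟨φ, fun v => ?_, fun u => (hφ u (hlt u)).2⟩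
  by_cases hv : m v = 0
  · rw [hφ0 v hv, hφ0 _ (hf0 v hv)]
    exact h₁ v hv
  · exact (hφ (f v) (hlt _)).1 v hv rfl

/-- If every vertex lies on the cycle of the parent map and the cycle has length five, then the
graph is `C_5`. -/
theorem SimpleGraph.nonempty_iso_cycleGraph_five {V : Type*} {G : SimpleGraph V} {f : V → V}
    {h : V → ℕ} (hlt : ∀ v, h v < 5) (hinj : Function.Injective h) (hsurj : ∀ k < 5, ∃ v, h v = k)
    (hf : ∀ v, h (f v) = if h v = 0 then 4 else h v - 1)
    (hadj : ∀ u v, G.Adj u v ↔ f u = v ∨ f v = u) :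
    Nonempty (G ≃g SimpleGraph.cycleGraph 5) := by
  have hbij : Function.Bijective (fun v => (⟨h v, hlt v⟩ : Fin 5)) :=
    ⟨fun u v huv => hinj (congrArg Fin.val huv), fun k => by
      obtain ⟨v, hv⟩ := hsurj k k.2
      exact ⟨v, Fin.ext hv⟩⟩
  refine ⟨⟨Equiv.ofBijective _ hbij, fun {u v} => ?_⟩⟩
  have hfuv : ∀ u v, f u = v ↔ (if h u = 0 then 4 else h u - 1) = h v := fun u v => by
    rw [← hinj.eq_iff, hf]
  have hdec : ∀ i j : Fin 5, (SimpleGraph.cycleGraph 5).Adj i j ↔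
      (if i.val = 0 then 4 else i.val - 1) = j.val ∨
        (if j.val = 0 then 4 else j.val - 1) = i.val := by
    simp only [SimpleGraph.cycleGraph_adj']
    decide
  rw [hadj, hfuv, hfuv]
  exact hdec ⟨h u, hlt u⟩ ⟨h v, hlt v⟩

/-- Every finite connected unicyclic graph (number of edges equals number of vertices)
other than `C_5` has strong odd chromatic number at most 4. -/
theorem strongOddChromaticNumber_le_four_of_unicyclic {V : Type*} [Fintype V]
    (G : SimpleGraph V) (hconn : G.Connected)
    (hcard : Nat.card G.edgeSet = Fintype.card V)
    (hC5 : ¬ Nonempty (G ≃g SimpleGraph.cycleGraph 5)) :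
    G.strongOddChromaticNumber ≤ 4 := by
  classical
  obtain ⟨f, h, a, h0, hs, h2, hadj⟩ := SimpleGraph.exists_parent_map hconn hcard
  obtain ⟨N, hN⟩ : ∃ N, N = h (f a) + 1 := ⟨_, rfl⟩
  have ha0 : h a = 0 := (h0 a).2 rfl
  have hf : ∀ v, h (f v) = if h v = 0 then N - 1 else h v - 1 := by
    intro v
    by_cases hv : v = a
    · rw [hv, if_pos ha0, hN]; rfl
    · have := hs v hv
      rw [if_neg (by omega)]; omega
  have hff : ∀ v, f (f v) ≠ v := by
    intro v hv
    have e1 := hf v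
    have e2 := hf (f v)
    rw [hv] at e2
    split_ifs at e1 e2 <;> omega
  have hroot : ∀ n v, h v = n → f^[n] v = a := by
    intro n
    induction n with
    | zero => exact fun v hv => (h0 v).1 hv
    | succ n ih =>
      intro v hv
      rw [Function.iterate_succ_apply]
      exact ih (f v) (by rw [hf, if_neg (by omega)]; omega)
  have hback : f^[N - 1] (f a) = a := hroot _ _ (by omega)
  have hC : ∀ i, h (f^[i] a) < N ∧ f^[N - 1 - h (f^[i] a)] (f a) = f^[i] a := by
    intro i
    induction i with
    | zero =>
      simp only [Function.iterate_zero, id_eq, ha0]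
      exact ⟨by omega, hback⟩
    | succ i ih =>
      rw [Function.iterate_succ_apply', hf]
      split_ifs with hz
      · rw [(h0 _).1 hz]
        exact ⟨by omega, by simp⟩
      · refine ⟨by omega, ?_⟩
        rw [show N - 1 - (h (f^[i] a) - 1) = (N - 1 - h (f^[i] a)) + 1 by omega,
          Function.iterate_succ_apply', ih.2]
  set C : V → Prop := fun v => ∃ i, f^[i] a = v with hCdef
  have hClt : ∀ v, C v → h v < N := by
    rintro v ⟨i, rfl⟩
    exact (hC i).1
  have hCinj : ∀ u v, C u → C v → h u = h v → u = v := by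
    rintro u v ⟨i, rfl⟩ ⟨j, rfl⟩ huv
    rw [← (hC i).2, ← (hC j).2, huv]
  have hCf : ∀ v, C v → C (f v) := by
    rintro v ⟨i, rfl⟩
    exact ⟨i + 1, Function.iterate_succ_apply' f i a⟩
  have hCa : C a := ⟨0, rfl⟩
  have hCr : ∀ v, C v → ∃ w, C w ∧ f w = v := by
    rintro v ⟨_ | i, rfl⟩
    · refine ⟨f^[N - 1] a, ⟨_, rfl⟩, ?_⟩
      rw [← Function.iterate_succ_apply' f, Function.iterate_succ_apply]
      exact hback
    · exact ⟨f^[i] a, ⟨i, rfl⟩, (Function.iterate_succ_apply' f i a).symm⟩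
  have hCfinj : ∀ u v, C u → C v → f u = f v → u = v := by
    intro u v hu hv huv
    apply hCinj u v hu hv
    have e1 := hf u
    have e2 := hf v
    rw [huv] at e1
    have := hClt u hu
    have := hClt v hv
    split_ifs at e1 e2 <;> omega
  choose! r hr0 hfr using hCr
  have hex : ∀ v, ∃ k, C (f^[k] v) := fun v => ⟨h v, by rw [hroot _ v rfl]; exact hCa⟩
  set m : V → ℕ := fun v => Nat.find (hex v) with hm
  have hm0 : ∀ v, m v = 0 ↔ C v := fun v => by simp [hm]
  have hms : ∀ v, m v ≠ 0 → m v = m (f v) + 1 := by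
    intro v hv
    exact Nat.find_comp_succ (hex v) (hex (f v)) (by simpa [hm] using hv)
  obtain ⟨s, hs5, hsx⟩ : ∃ s, (N = 5 → s < 5) ∧
      (N = 5 → ∃ x, m x ≠ 0 ∧ C (f x) ∧ h (f x) = s) := by
    by_cases h5 : N = 5
    · by_cases hx : ∃ x, ¬ C x ∧ C (f x)
      · obtain ⟨x, hx, hfx⟩ := hx
        exact ⟨h (f x), fun _ => h5 ▸ hClt _ hfx, fun _ => ⟨x, fun h => hx ((hm0 x).1 h), hfx, rfl⟩⟩
      · push Not at hx
        have hall : ∀ n v, h v = n → C v := by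
          intro n
          induction n with
          | zero => exact fun v hv => (h0 v).1 hv ▸ hCa
          | succ n ih =>
            intro v hv
            by_contra hcv
            exact hx v hcv (ih (f v) (by rw [hf, if_neg (by omega)]; omega))
        have hval : ∀ i, i < N → h (f^[i] (f a)) = N - 1 - i := by
          intro i
          induction i with
          | zero => exact fun _ => by simp [hN]
          | succ i ih =>
            intro hi
            rw [Function.iterate_succ_apply', hf, ih (by omega), if_neg (by omega)]
            omega
        refine absurd (SimpleGraph.nonempty_iso_cycleGraph_five (f := f) (h := h)
          (fun v => h5 ▸ hClt v (hall _ v rfl))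
          (fun u v huv => hCinj u v (hall _ u rfl) (hall _ v rfl) huv)
          (fun k hk => ⟨f^[4 - k] (f a), by rw [hval _ (by omega)]; omega⟩)
          (fun v => by rw [hf v, h5]) hadj) hC5
    · exact ⟨0, fun h => absurd h h5, fun h => absurd h h5⟩
  obtain ⟨g, hg⟩ := exists_cycle_colors N s (by omega) hs5
  obtain ⟨φ, hφ1, hφ2⟩ := exists_extend_odd f r m (fun v => g (h v)) hms hff
    (fun v hv => (hm0 _).2 (hCf v ((hm0 v).1 hv)))
    (fun v hv => (hm0 _).2 (hr0 v ((hm0 v).1 hv)))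
    (fun v hv => hfr v ((hm0 v).1 hv))
    (fun v hv => by
      have hv := (hm0 v).1 hv
      exact hCfinj _ _ (hr0 _ (hCf v hv)) hv (hfr _ (hCf v hv)))
    (fun v hv => (hg _ _ _ (hClt v ((hm0 v).1 hv)) (hf v) (hf (f v))).1)
    (fun v hv heq => by
      have hv := (hm0 v).1 hv
      obtain ⟨h5, hfs⟩ := (hg _ _ _ (hClt v hv) (hf v) (hf (f v))).2 heq
      obtain ⟨x, hx, hCx, hxs⟩ := hsx h5
      exact ⟨x, hx, hCinj _ _ hCx (hCf v hv) (hxs.trans hfs.symm)⟩)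
  refine Nat.sInf_le ⟨φ, fun u v huv => ?_, fun v c => ?_⟩
  · rcases (hadj u v).1 huv with rfl | rfl
    · exact hφ1 u
    · exact (hφ1 v).symm
  · have hcount : Nat.card {u // G.Adj v u ∧ φ u = c} =
        (Finset.univ.filter (fun x => (f v = x ∨ f x = v) ∧ φ x = c)).card := by
      rw [Nat.card_eq_fintype_card, Fintype.card_subtype]
      simp only [hadj]
    rw [hcount]
    exact hφ2 v c
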